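/- Let g ∈ SL(n+1, ℝ) and let g* = σ^{-1}(g^T)^{-1}σ be its dual, where σ is the anti-diagonal involution matrix. Then for every 1 ≤ i ≤ n+1, 1 ≤ λ_i(g ℤ^{n+1}) · λ_{n+2−i}(g* ℤ^{n+1}) ≤ ((n+1)!)². -/

import Mathlib

/-- The Euclidean norm on `Fin m → ℝ`. -/
noncomputable def euclNorm {m : ℕ} (v : Fin m → ℝ) : ℝ :=
  Real.sqrt (∑ i, v i ^ 2)

/-- The lattice `g ℤ^m` as a set of vectors. -/
def latticeOf {m : ℕ} (g : Matrix (Fin m) (Fin m) ℝ) : Set (Fin m → ℝ) :=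
  {x | ∃ v : Fin m → ℤ, x = g.mulVec fun i => (v i : ℝ)}

/-- The `i`-th successive minimum of a set `Λ ⊆ ℝ^m` with respect to the closed
Euclidean unit ball. -/
noncomputable def succMin {m : ℕ} (Λ : Set (Fin m → ℝ)) (i : ℕ) : ℝ :=
  sInf {l : ℝ | 0 < l ∧ ∃ w : Fin i → (Fin m → ℝ),
    (∀ j, w j ∈ Λ ∧ euclNorm (w j) ≤ l) ∧ LinearIndependent ℝ w}

/-- The `(n+1) × (n+1)` anti-diagonal involution matrix. -/
def sigmaMat (n : ℕ) : Matrix (Fin (n + 1)) (Fin (n + 1)) ℝ :=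
  fun i j => if (i : ℕ) + (j : ℕ) = n then 1 else 0

/-- The dual `g* = σ⁻¹ (gᵀ)⁻¹ σ`. -/
noncomputable def dualMat (n : ℕ) (g : Matrix (Fin (n + 1)) (Fin (n + 1)) ℝ) :
    Matrix (Fin (n + 1)) (Fin (n + 1)) ℝ :=
  (sigmaMat n)⁻¹ * (g.transpose)⁻¹ * sigmaMat n

open Matrix

lemma Nat.self_pow_le_factorial_sq (m : ℕ) : m ^ m ≤ m.factorial ^ 2 := by
  have h : m.factorial ^ 2 = ∏ k ∈ Finset.range m, (k + 1) * (m - 1 - k + 1) := by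
    rw [Finset.prod_mul_distrib, Finset.prod_range_reflect (fun k => k + 1) m,
      Finset.prod_range_add_one_eq_factorial, sq]
  calc m ^ m = ∏ _k ∈ Finset.range m, m := by simp
    _ ≤ _ := by
      rw [h]
      refine Finset.prod_le_prod' fun k hk => ?_
      obtain ⟨d, rfl⟩ : ∃ d, m = k + 1 + d :=
        Nat.exists_eq_add_of_le (Nat.succ_le_of_lt (Finset.mem_range.mp hk))
      rw [show k + 1 + d - 1 - k + 1 = d + 1 by omega]
      nlinarith [Nat.zero_le (k * d)]

/-- **Minkowski's linear forms theorem**, with strict inequalities. -/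
lemma exists_int_mulVec_abs_lt {m : ℕ} (A : Matrix (Fin m) (Fin m) ℝ) (hA : |A.det| = 1)
    (c : Fin m → ℝ) (hc : ∀ k, 0 < c k) (hprod : 1 < ∏ k, c k) :
    ∃ v : Fin m → ℤ, v ≠ 0 ∧ ∀ k, |(A *ᵥ fun i => (v i : ℝ)) k| < c k := by
  have hdet : LinearMap.det (Matrix.toLin' A) ≠ 0 := by
    rw [LinearMap.det_toLin']
    intro h
    simp [h] at hA
  set B : Set (Fin m → ℝ) := Set.univ.pi fun k => Set.Ioo (-c k) (c k)
  have hB : MeasureTheory.volume ((Matrix.toLin' A) ⁻¹' B) =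
      ENNReal.ofReal (2 ^ m * ∏ k, c k) := by
    rw [MeasureTheory.Measure.addHaar_preimage_linearMap _ hdet, Real.volume_pi_Ioo,
      LinearMap.det_toLin', abs_inv, hA, inv_one, ENNReal.ofReal_one, one_mul,
      ← ENNReal.ofReal_prod_of_nonneg fun k _ => by linarith [hc k]]
    congr 1
    rw [Finset.prod_congr rfl fun k _ => show c k - -c k = 2 * c k by ring,
      Finset.prod_mul_distrib]
    simp
  have hcount : Countable (Submodule.span ℤ (Set.range (Pi.basisFun ℝ (Fin m)))).toAddSubgroup :=
    inferInstanceAs (Countable (Submodule.span ℤ (Set.range (Pi.basisFun ℝ (Fin m)))))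
  obtain ⟨x, hx0, hx⟩ :=
    MeasureTheory.exists_ne_zero_mem_lattice_of_measure_mul_two_pow_lt_measure
      (ZSpan.isAddFundamentalDomain' (Pi.basisFun ℝ (Fin m)) MeasureTheory.volume)
      (s := (Matrix.toLin' A) ⁻¹' B)
      (fun x hx k hk => by
        have := hx k hk
        rw [map_neg]
        exact ⟨neg_lt_neg this.2, by simpa using neg_lt_neg this.1⟩)
      ((convex_pi fun k _ => convex_Ioo _ _).linear_preimage _)
      (by
        rw [hB, ZSpan.fundamentalDomain_pi_basisFun, MeasureTheory.volume_pi,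
          MeasureTheory.Measure.pi_pi]
        simp only [Real.volume_Ico, sub_zero, ENNReal.ofReal_one, Finset.prod_const_one, one_mul,
          Module.finrank_fintype_fun_eq_card, Fintype.card_fin]
        rw [← ENNReal.ofReal_ofNat, ← ENNReal.ofReal_pow (by norm_num),
          ENNReal.ofReal_lt_ofReal_iff (by positivity)]
        nlinarith [pow_pos (two_pos : (0 : ℝ) < 2) m])
  have hmem := ((Pi.basisFun ℝ (Fin m)).mem_span_iff_repr_mem ℤ (x : Fin m → ℝ)).mp x.2
  choose v hv using hmem
  have hvx : (fun i => (v i : ℝ)) = (x : Fin m → ℝ) := by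
    funext i
    simpa using hv i
  refine ⟨v, fun h => hx0 (Subtype.ext ?_), fun k => ?_⟩
  · rw [← hvx, h]
    funext i
    simp
  · rw [hvx, abs_lt]
    exact hx k trivial

lemma euclNorm_nonneg {m : ℕ} (v : Fin m → ℝ) : 0 ≤ euclNorm v := Real.sqrt_nonneg _

lemma euclNorm_sq {m : ℕ} (v : Fin m → ℝ) : euclNorm v ^ 2 = v ⬝ᵥ v := by
  rw [euclNorm, Real.sq_sqrt (Finset.sum_nonneg fun _ _ => sq_nonneg _)]
  simp [dotProduct, sq]

lemma euclNorm_pos {m : ℕ} {v : Fin m → ℝ} (hv : v ≠ 0) : 0 < euclNorm v := by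
  refine (euclNorm_nonneg v).lt_of_ne fun h => hv ?_
  rw [← dotProduct_self_eq_zero, ← euclNorm_sq, ← h]
  simp

lemma abs_dotProduct_le_euclNorm_mul {m : ℕ} (v w : Fin m → ℝ) :
    |v ⬝ᵥ w| ≤ euclNorm v * euclNorm w := by
  refine abs_le_of_sq_le_sq ?_ (mul_nonneg (euclNorm_nonneg v) (euclNorm_nonneg w))
  rw [mul_pow, euclNorm, euclNorm, Real.sq_sqrt (Finset.sum_nonneg fun _ _ => sq_nonneg _),
    Real.sq_sqrt (Finset.sum_nonneg fun _ _ => sq_nonneg _)]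
  exact Finset.sum_mul_sq_le_sq_mul_sq _ _ _

lemma exists_unit_dotProduct_eq_zero {m : ℕ} (W : Submodule ℝ (Fin m → ℝ))
    (hW : Module.finrank ℝ W < m) :
    ∃ u : Fin m → ℝ, u ⬝ᵥ u = 1 ∧ ∀ w ∈ W, u ⬝ᵥ w = 0 := by
  have hlt : W < ⊤ := lt_top_iff_ne_top.mpr fun h => by
    rw [h, finrank_top, Module.finrank_fin_fun] at hW
    exact hW.false
  obtain ⟨f, hf, hWf⟩ := W.exists_le_ker_of_lt_top hlt
  obtain ⟨u, rfl⟩ := (dotProductEquiv ℝ (Fin m)).surjective f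
  have hu : u ≠ 0 := by
    rintro rfl
    exact hf (map_zero _)
  have hpos := euclNorm_pos hu
  refine ⟨(euclNorm u)⁻¹ • u, ?_, fun w hw => ?_⟩
  · rw [smul_dotProduct, dotProduct_smul, ← euclNorm_sq]
    simp only [smul_eq_mul]
    field_simp
  · have : u ⬝ᵥ w = 0 := hWf hw
    rw [smul_dotProduct, this, smul_zero]

lemma exists_orthonormal_dotProduct_eq_zero {m : ℕ} (U : ℕ → Submodule ℝ (Fin m → ℝ))
    (r : ℕ) (hU : ∀ j < r, Module.finrank ℝ (U j) + j < m) :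
    ∃ e : Fin r → (Fin m → ℝ), (∀ i j, e i ⬝ᵥ e j = if i = j then 1 else 0) ∧
      ∀ j : Fin r, ∀ w ∈ U j, e j ⬝ᵥ w = 0 := by
  induction r with
  | zero => exact ⟨Fin.elim0, fun i => i.elim0, fun i => i.elim0⟩
  | succ r ih =>
    obtain ⟨e, he, heU⟩ := ih fun j hj => hU j (by omega)
    obtain ⟨u, hu, huW⟩ := exists_unit_dotProduct_eq_zero
      (U r ⊔ Submodule.span ℝ (Set.range e)) (by
        have h1 := Submodule.finrank_add_le_finrank_add_finrank (U r)
          (Submodule.span ℝ (Set.range e))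
        have h2 := finrank_range_le_card (R := ℝ) e
        rw [Fintype.card_fin, Set.finrank] at h2
        have h3 := hU r (by omega)
        omega)
    have hue : ∀ i, u ⬝ᵥ e i = 0 := fun i =>
      huW _ (Submodule.mem_sup_right (Submodule.subset_span ⟨i, rfl⟩))
    refine ⟨Fin.snoc e u, fun i j => ?_, fun j => ?_⟩
    · induction i using Fin.lastCases <;> induction j using Fin.lastCases
      · simpa using hu
      · simpa [Fin.ext_iff, (Fin.is_lt _).ne'] using hue _
      · simpa [Fin.ext_iff, (Fin.is_lt _).ne, dotProduct_comm] using hue _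
      · simpa using he _ _
    · induction j using Fin.lastCases
      · simpa using fun w hw => huW w (Submodule.mem_sup_left hw)
      · simpa using heU _

lemma succMin_nonneg {m : ℕ} (Λ : Set (Fin m → ℝ)) (i : ℕ) : 0 ≤ succMin Λ i :=
  Real.sInf_nonneg fun _ h => h.1.le

lemma succMin_le {m : ℕ} {Λ : Set (Fin m → ℝ)} {i : ℕ} {l : ℝ} (hl : 0 < l)
    (w : Fin i → (Fin m → ℝ)) (hw : ∀ j, w j ∈ Λ ∧ euclNorm (w j) ≤ l)
    (hli : LinearIndependent ℝ w) : succMin Λ i ≤ l :=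
  csInf_le ⟨0, fun _ h => h.1.le⟩ ⟨hl, w, hw, hli⟩

lemma finrank_span_euclNorm_lt_succMin {m : ℕ} (Λ : Set (Fin m → ℝ)) (k : ℕ) :
    Module.finrank ℝ (Submodule.span ℝ {x ∈ Λ | euclNorm x < succMin Λ (k + 1)}) ≤ k := by
  by_contra! h
  obtain ⟨f, hf, -, hli⟩ := Submodule.exists_fun_fin_finrank_span_eq ℝ
    {x ∈ Λ | euclNorm x < succMin Λ (k + 1)}
  have hli' := hli.comp (Fin.castLE h) (Fin.castLE_injective h)
  set w := f ∘ Fin.castLE h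
  obtain ⟨j, -, hj⟩ := Finset.exists_max_image Finset.univ (fun j => euclNorm (w j))
    Finset.univ_nonempty
  exact (hf (Fin.castLE h j)).2.not_ge <|
    succMin_le (euclNorm_pos (hli'.ne_zero j)) w (fun i => ⟨(hf _).1, hj i (Finset.mem_univ i)⟩) hli'

lemma succMin_set_nonempty {m : ℕ} {A : Matrix (Fin m) (Fin m) ℝ} (hA : |A.det| = 1)
    {i : ℕ} (hi : i ≤ m) :
    {l : ℝ | 0 < l ∧ ∃ w : Fin i → (Fin m → ℝ),
      (∀ j, w j ∈ latticeOf A ∧ euclNorm (w j) ≤ l) ∧ LinearIndependent ℝ w}.Nonempty := by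
  have hu : IsUnit A := by
    rw [Matrix.isUnit_iff_isUnit_det, isUnit_iff_ne_zero]
    intro h
    simp [h] at hA
  have hli := (Matrix.linearIndependent_cols_iff_isUnit.mpr hu).comp _ (Fin.castLE_injective hi)
  refine ⟨1 + ∑ j, euclNorm (A.col (Fin.castLE hi j)), ?_, A.col ∘ Fin.castLE hi,
    fun j => ⟨⟨Pi.single (Fin.castLE hi j) 1, ?_⟩, ?_⟩, hli⟩
  · have := Finset.sum_nonneg fun (j : Fin i) (_ : j ∈ Finset.univ) =>
      euclNorm_nonneg (A.col (Fin.castLE hi j))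
    linarith
  · have : (fun k => ((Pi.single (Fin.castLE hi j) (1 : ℤ) : Fin m → ℤ) k : ℝ)) =
        Pi.single (Fin.castLE hi j) 1 := by
      funext k
      by_cases hk : k = Fin.castLE hi j <;> simp [hk]
    rw [this, Matrix.mulVec_single_one]
    rfl
  · have := Finset.single_le_sum (f := fun j => euclNorm (A.col (Fin.castLE hi j)))
      (fun j _ => euclNorm_nonneg _) (Finset.mem_univ j)
    simp only [Function.comp] at this ⊢
    linarith

/-- **Minkowski's second theorem** for the Euclidean ball and unimodular lattices, with the
constant coming from the inscribed cube. -/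
lemma prod_succMin_le {m : ℕ} (hm : 0 < m) {A : Matrix (Fin m) (Fin m) ℝ} (hA : |A.det| = 1)
    (hpos : ∀ k : Fin m, 0 < succMin (latticeOf A) (k + 1)) :
    ∏ k : Fin m, succMin (latticeOf A) (k + 1) ≤ √m ^ m := by
  by_contra! hlt
  set l : Fin m → ℝ := fun k => succMin (latticeOf A) (k + 1)
  have hm' : (0 : ℝ) < √m := Real.sqrt_pos.mpr (by exact_mod_cast hm)
  obtain ⟨e, he, heU⟩ := exists_orthonormal_dotProduct_eq_zero
    (fun j => Submodule.span ℝ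
      {x ∈ latticeOf A | euclNorm x < succMin (latticeOf A) (m - 1 - j + 1)})
    m (fun j hj => by
      have := finrank_span_euclNorm_lt_succMin (latticeOf A) (m - 1 - j)
      omega)
  set Q : Matrix (Fin m) (Fin m) ℝ := Matrix.of fun k => e k.rev
  have hQQ : Q * Qᵀ = 1 := by
    ext i j
    have := he i.rev j.rev
    simp only [Fin.rev_inj] at this
    rw [Matrix.one_apply]
    exact this
  have hQ : |(Q * A).det| = 1 := by
    have := congrArg Matrix.det hQQ
    rw [Matrix.det_mul, Matrix.det_transpose, Matrix.det_one, ← sq, ← sq_abs,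
      pow_eq_one_iff_of_nonneg (abs_nonneg _) two_ne_zero] at this
    rw [Matrix.det_mul, abs_mul, hA, mul_one, this]
  obtain ⟨v, hv0, hv⟩ := exists_int_mulVec_abs_lt (Q * A) hQ (fun k => l k / √m)
    (fun k => div_pos (hpos k) hm') (by
      rw [Finset.prod_div_distrib, one_lt_div (by positivity)]
      simpa using hlt)
  set x := A *ᵥ fun i => (v i : ℝ)
  have hx : x ∈ latticeOf A := ⟨v, rfl⟩
  simp only [← Matrix.mulVec_mulVec] at hv
  set y := Q *ᵥ x
  have hxy : x ⬝ᵥ x = ∑ k, y k ^ 2 := by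
    have : x = Qᵀ *ᵥ y := by
      rw [Matrix.mulVec_mulVec, mul_eq_one_comm.mp hQQ, Matrix.one_mulVec]
    rw [Finset.sum_congr rfl fun k _ => sq (y k)]
    change x ⬝ᵥ x = y ⬝ᵥ y
    nth_rewrite 1 [this]
    rw [Matrix.mulVec_transpose, ← Matrix.dotProduct_mulVec]
  have hx0 : x ≠ 0 := by
    intro h
    refine hv0 (funext fun i => ?_)
    have := Matrix.eq_zero_of_mulVec_eq_zero (M := A) (by intro h; simp [h] at hA) h
    exact Int.cast_eq_zero.mp (congrFun this i)
  obtain ⟨k, hk, hmax⟩ := Finset.exists_max_image (Finset.univ.filter fun k => y k ≠ 0) l (by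
    by_contra hne
    rw [Finset.not_nonempty_iff_eq_empty, Finset.filter_eq_empty_iff] at hne
    refine hx0 (dotProduct_self_eq_zero.mp ?_)
    rw [hxy]
    exact Finset.sum_eq_zero fun k hk => by simpa using hne hk)
  have hyk : y k ≠ 0 := (Finset.mem_filter.mp hk).2
  have hsq : ∀ j, y j ^ 2 < l j ^ 2 / m := fun j => by
    have := sq_lt_sq' (abs_lt.mp (hv j)).1 (abs_lt.mp (hv j)).2
    rwa [div_pow, Real.sq_sqrt (Nat.cast_nonneg m)] at this
  have hnorm : euclNorm x < l k := by
    refine lt_of_pow_lt_pow_left₀ 2 (hpos k).le ?_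
    rw [euclNorm_sq, hxy]
    calc ∑ j, y j ^ 2 < ∑ _j : Fin m, l k ^ 2 / m := by
          refine Finset.sum_lt_sum (fun j _ => ?_) ⟨k, Finset.mem_univ k, hsq k⟩
          by_cases hj : y j = 0
          · rw [hj, zero_pow two_ne_zero]
            exact div_nonneg (sq_nonneg _) (Nat.cast_nonneg m)
          · refine (hsq j).le.trans ?_
            have := hmax j (Finset.mem_filter.mpr ⟨Finset.mem_univ j, hj⟩)
            have := (hpos j).le
            gcongr
      _ = l k ^ 2 := by
          rw [Finset.sum_const, Finset.card_fin, nsmul_eq_mul]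
          field_simp
  refine hyk (heU k.rev x (Submodule.subset_span ⟨hx, ?_⟩))
  rw [Fin.val_rev, show m - 1 - (m - (k + 1)) + 1 = (k : ℕ) + 1 by omega]
  exact hnorm

/-- Two linearly independent families of total size exceeding the dimension cannot be mutually
orthogonal. -/
lemma exists_dotProduct_ne_zero {m i j : ℕ} (hij : m < i + j) {w : Fin i → (Fin m → ℝ)}
    {u : Fin j → (Fin m → ℝ)} (hw : LinearIndependent ℝ w) (hu : LinearIndependent ℝ u) :
    ∃ a b, w a ⬝ᵥ u b ≠ 0 := by
  by_contra! h
  have h0 : Matrix.of w * (Matrix.of u)ᵀ = 0 := by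
    ext a b
    exact h a b
  have := Matrix.rank_add_rank_le_card_of_mul_eq_zero h0
  rw [Matrix.rank_transpose, LinearIndependent.rank_matrix (M := Matrix.of w) hw,
    LinearIndependent.rank_matrix (M := Matrix.of u) hu] at this
  simp at this
  omega

lemma sigmaMat_eq (n : ℕ) :
    sigmaMat n = (1 : Matrix (Fin (n + 1)) (Fin (n + 1)) ℝ).submatrix Fin.rev id := by
  ext i j
  simp only [sigmaMat, Matrix.submatrix_apply, Matrix.one_apply, Fin.ext_iff, Fin.val_rev, id]
  congr 1
  rw [eq_iff_iff]
  omega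

lemma sigmaMat_mul_self (n : ℕ) : sigmaMat n * sigmaMat n = 1 := by
  ext i j
  rw [Matrix.mul_apply, Finset.sum_eq_single i.rev]
  · simp [sigmaMat_eq, Matrix.one_apply]
  · intro k _ hk
    simp [sigmaMat_eq, Matrix.one_apply, hk.symm]
  · simp

lemma dualMat_eq (n : ℕ) (g : Matrix (Fin (n + 1)) (Fin (n + 1)) ℝ) :
    dualMat n g = sigmaMat n * gᵀ⁻¹ * sigmaMat n := by
  rw [dualMat, Matrix.inv_eq_left_inv (sigmaMat_mul_self n)]

lemma sigmaMat_mulVec (n : ℕ) (x : Fin (n + 1) → ℝ) : sigmaMat n *ᵥ x = x ∘ Fin.rev := by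
  funext i
  simp [sigmaMat_eq, Matrix.mulVec, dotProduct, Matrix.one_apply]

lemma abs_det_dualMat (n : ℕ) {g : Matrix (Fin (n + 1)) (Fin (n + 1)) ℝ} (hg : g.det = 1) :
    |(dualMat n g).det| = 1 := by
  have h := congrArg Matrix.det (sigmaMat_mul_self n)
  rw [Matrix.det_mul, Matrix.det_one] at h
  rw [dualMat_eq, Matrix.det_mul, Matrix.det_mul, mul_right_comm, h, Matrix.det_nonsing_inv,
    Matrix.det_transpose, hg]
  simp

lemma euclNorm_comp_rev {n : ℕ} (x : Fin n → ℝ) : euclNorm (x ∘ Fin.rev) = euclNorm x := by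
  unfold euclNorm
  congr 1
  exact Equiv.sum_comp Fin.revPerm fun i => x i ^ 2

/-- Up to reversing coordinates, `g ℤ^(n+1)` and its dual lattice pair integrally. -/
lemma exists_int_dotProduct_dualMat {n : ℕ} {g : Matrix (Fin (n + 1)) (Fin (n + 1)) ℝ}
    (hg : g.det = 1) {x y : Fin (n + 1) → ℝ} (hx : x ∈ latticeOf g)
    (hy : y ∈ latticeOf (dualMat n g)) : ∃ z : ℤ, x ⬝ᵥ (y ∘ Fin.rev) = z := by
  obtain ⟨v, rfl⟩ := hx
  obtain ⟨w, rfl⟩ := hy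
  refine ⟨v ⬝ᵥ (w ∘ Fin.rev), ?_⟩
  have hgu : IsUnit gᵀ.det := by simp [hg]
  rw [← sigmaMat_mulVec, Matrix.mulVec_mulVec, dualMat_eq, ← Matrix.mul_assoc, ← Matrix.mul_assoc,
    sigmaMat_mul_self, Matrix.one_mul, ← Matrix.mulVec_mulVec, sigmaMat_mulVec,
    dotProduct_comm, Matrix.dotProduct_mulVec, ← Matrix.mulVec_transpose, Matrix.mulVec_mulVec,
    Matrix.mul_nonsing_inv _ hgu, Matrix.one_mulVec, dotProduct_comm]
  simp [dotProduct]

lemma one_le_succMin_mul_succMin {n : ℕ} {g : Matrix (Fin (n + 1)) (Fin (n + 1)) ℝ}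
    (hg : g.det = 1) {i j : ℕ} (hi : i ≤ n + 1) (hj : j ≤ n + 1) (hij : n + 1 < i + j) :
    1 ≤ succMin (latticeOf g) i * succMin (latticeOf (dualMat n g)) j := by
  have key : ∀ a ∈ {l : ℝ | 0 < l ∧ ∃ w : Fin i → (Fin (n + 1) → ℝ),
        (∀ j, w j ∈ latticeOf g ∧ euclNorm (w j) ≤ l) ∧ LinearIndependent ℝ w},
      ∀ b ∈ {l : ℝ | 0 < l ∧ ∃ w : Fin j → (Fin (n + 1) → ℝ),
        (∀ j, w j ∈ latticeOf (dualMat n g) ∧ euclNorm (w j) ≤ l) ∧ LinearIndependent ℝ w},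
      1 ≤ a * b := by
    rintro a ⟨ha, w, hw, hwi⟩ b ⟨hb, u, hu, hui⟩
    have hui' : LinearIndependent ℝ fun k => u k ∘ Fin.rev :=
      hui.map' (LinearMap.funLeft ℝ ℝ Fin.rev)
        (LinearMap.ker_eq_bot.mpr (LinearMap.funLeft_injective_of_surjective _ _ _
          Fin.rev_surjective))
    obtain ⟨s, t, hst⟩ := exists_dotProduct_ne_zero hij hwi hui'
    obtain ⟨z, hz⟩ := exists_int_dotProduct_dualMat hg (hw s).1 (hu t).1
    have hle := abs_dotProduct_le_euclNorm_mul (w s) (u t ∘ Fin.rev)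
    rw [euclNorm_comp_rev] at hle
    rw [hz] at hst hle
    have hz1 : (1 : ℝ) ≤ |(z : ℝ)| := by
      exact_mod_cast Int.one_le_abs (by exact_mod_cast hst)
    exact hz1.trans (hle.trans (mul_le_mul (hw s).2 (hu t).2 (euclNorm_nonneg _) ha.le))
  have hne := succMin_set_nonempty (A := g) (by simp [hg]) hi
  have hne' := succMin_set_nonempty (abs_det_dualMat n hg) hj
  have h1 : ∀ b ∈ {l : ℝ | 0 < l ∧ ∃ w : Fin j → (Fin (n + 1) → ℝ),
      (∀ j, w j ∈ latticeOf (dualMat n g) ∧ euclNorm (w j) ≤ l) ∧ LinearIndependent ℝ w},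
      1 ≤ succMin (latticeOf g) i * b := fun b hb => by
    rw [← div_le_iff₀ hb.1]
    exact le_csInf hne fun a ha => (div_le_iff₀ hb.1).mpr (key a ha b hb)
  have hpos : 0 < succMin (latticeOf g) i := by
    obtain ⟨b, hb⟩ := hne'
    exact pos_of_mul_pos_left (one_pos.trans_le (h1 b hb)) hb.1.le
  rw [← div_le_iff₀' hpos]
  exact le_csInf hne' fun b hb => (div_le_iff₀' hpos).mpr (h1 b hb)

theorem succMin_dual_bounds (n : ℕ) (g : Matrix (Fin (n + 1)) (Fin (n + 1)) ℝ)
    (hg : g.det = 1) (i : ℕ) (hi : 1 ≤ i) (hi' : i ≤ n + 1) :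
    1 ≤ succMin (latticeOf g) i * succMin (latticeOf (dualMat n g)) (n + 2 - i) ∧
      succMin (latticeOf g) i * succMin (latticeOf (dualMat n g)) (n + 2 - i) ≤
        ((Nat.factorial (n + 1) : ℝ)) ^ 2 := by
  refine ⟨one_le_succMin_mul_succMin hg hi' (by omega) (by omega), ?_⟩
  set p : Fin (n + 1) → ℝ := fun k => succMin (latticeOf g) (k + 1)
  set q : Fin (n + 1) → ℝ := fun k => succMin (latticeOf (dualMat n g)) (k + 1)
  have hpq : ∀ k, 1 ≤ p k * q k.rev := fun k =>
    one_le_succMin_mul_succMin hg (by omega) (by omega) (by rw [Fin.val_rev]; omega)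
  have hp : ∀ k, 0 < p k := fun k =>
    pos_of_mul_pos_left (one_pos.trans_le (hpq k)) (succMin_nonneg _ _)
  have hq : ∀ k, 0 < q k := fun k => by
    have := hpq k.rev
    rw [Fin.rev_rev] at this
    exact pos_of_mul_pos_right (one_pos.trans_le this) (succMin_nonneg _ _)
  have hP := prod_succMin_le n.succ_pos (A := g) (by simp [hg]) hp
  have hQ := prod_succMin_le n.succ_pos (abs_det_dualMat n hg) hq
  have hmul : ∏ k, p k * q k.rev = (∏ k, p k) * ∏ k, q k := by
    rw [Finset.prod_mul_distrib]
    congr 1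
    exact Equiv.prod_comp Fin.revPerm q
  have hterm : p ⟨i - 1, by omega⟩ * q (Fin.rev ⟨i - 1, by omega⟩) ≤ ∏ k, p k * q k.rev := by
    rw [← Finset.mul_prod_erase _ _ (Finset.mem_univ (⟨i - 1, by omega⟩ : Fin (n + 1)))]
    refine le_mul_of_one_le_right (by linarith [hpq ⟨i - 1, by omega⟩]) ?_
    exact Finset.prod_induction _ (fun x => 1 ≤ x) (fun _ _ => one_le_mul_of_one_le_of_one_le)
      le_rfl fun k _ => hpq k
  have heq : succMin (latticeOf g) i * succMin (latticeOf (dualMat n g)) (n + 2 - i) =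
      p ⟨i - 1, by omega⟩ * q (Fin.rev ⟨i - 1, by omega⟩) := by
    simp only [p, q, Fin.val_rev]
    congr 2 <;> omega
  rw [heq]
  calc _ ≤ (∏ k, p k) * ∏ k, q k := hmul ▸ hterm
    _ ≤ √(n + 1 : ℕ) ^ (n + 1) * √(n + 1 : ℕ) ^ (n + 1) :=
        mul_le_mul hP hQ (Finset.prod_nonneg fun k _ => (hq k).le) (by positivity)
    _ = ((n + 1 : ℕ) : ℝ) ^ (n + 1) := by
        rw [← mul_pow, Real.mul_self_sqrt (Nat.cast_nonneg _)]
    _ ≤ _ := by exact_mod_cast Nat.self_pow_le_factorial_sq (n + 1)
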